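/- Let A ∈ ℝ^{n×n} with A − I symmetric positive definite, b ∈ ℝ^n, and f(x) = ⟨Ax, x⟩ − ⟨|x|, x⟩ − 2⟨b, x⟩. Let B₁, …, B_N be a partition of the index set {1, …, n} into N nonempty blocks, and let {x^{(k)}}_{k≥0} ⊆ ℝ^n be any sequence such that for each k ≥ 0, with s ∈ {1, …, N} chosen cyclically (s − 1 ≡ k mod N), the iterate x^{(k+1)} agrees with x^{(k)} in all coordinates outside B_s and minimizes f over all vectors that agree with x^{(k)} in all coordinates outside B_s. Then the sequence {x^{(k)}} has a limit point x_* ∈ ℝ^n satisfying Ax_* − |x_*| = b, i.e., x_* is the solution of the absolute value equation. -/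

import Mathlib

open Matrix

lemma aux_scalar (x h : ℝ) :
    |(|x + h| * (x + h) - |x| * x - 2 * (|x| * h))| ≤ h * h := by
  rw [abs_le]
  rcases abs_cases x with ⟨h1, h2⟩ | ⟨h1, h2⟩ <;>
  rcases abs_cases (x + h) with ⟨h3, h4⟩ | ⟨h3, h4⟩ <;> rw [h1, h3] <;>
  constructor <;> nlinarith

lemma aux_quad {n : ℕ} (M : Matrix (Fin n) (Fin n) ℝ) (hM : M.PosDef) :
    ∃ c : ℝ, 0 < c ∧ ∀ h : Fin n → ℝ, c * ‖h‖ ^ 2 ≤ M.mulVec h ⬝ᵥ h := by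
  have hpos : ∀ h : Fin n → ℝ, h ≠ 0 → 0 < M.mulVec h ⬝ᵥ h := by
    intro h hh
    have := hM.dotProduct_mulVec_pos hh
    rw [dotProduct_comm]
    simpa using this
  have hcont : Continuous (fun h : Fin n → ℝ => M.mulVec h ⬝ᵥ h) := by
    fun_prop
  rcases (Metric.sphere (0 : Fin n → ℝ) 1).eq_empty_or_nonempty with he | hne
  · refine ⟨1, one_pos, fun h => ?_⟩
    by_cases hh : h = 0
    · simp [hh]
    · exfalso
      have : (‖h‖⁻¹ • h) ∈ Metric.sphere (0 : Fin n → ℝ) 1 := by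
        simp [norm_smul, norm_ne_zero_iff.2 hh]
      rw [he] at this
      exact this
  · obtain ⟨u, hu, hmin⟩ := (isCompact_sphere (0 : Fin n → ℝ) 1).exists_isMinOn hne hcont.continuousOn
    have hu0 : u ≠ 0 := by
      rintro rfl
      simp at hu
    refine ⟨_, hpos u hu0, fun h => ?_⟩
    by_cases hh : h = 0
    · simp [hh]
    · have hn : ‖h‖ ≠ 0 := norm_ne_zero_iff.2 hh
      have hm : (‖h‖⁻¹ • h) ∈ Metric.sphere (0 : Fin n → ℝ) 1 := by
        simp [norm_smul, hn]
      have h1 := hmin hm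
      simp only [Set.mem_ofPred_eq, mulVec_smul, smul_dotProduct, dotProduct_smul, smul_eq_mul] at h1
      calc _ ≤ (‖h‖⁻¹ * (‖h‖⁻¹ * (M *ᵥ h ⬝ᵥ h))) * ‖h‖ ^ 2 := by gcongr
        _ = _ := by field_simp

lemma aux_expand {n : ℕ} (A : Matrix (Fin n) (Fin n) ℝ) (hA : Aᵀ = A) (b x h : Fin n → ℝ) :
    A.mulVec (x + h) ⬝ᵥ (x + h) - (fun i => |(x + h) i|) ⬝ᵥ (x + h) - 2 * (b ⬝ᵥ (x + h))
    = (A.mulVec x ⬝ᵥ x - (fun i => |x i|) ⬝ᵥ x - 2 * (b ⬝ᵥ x))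
      + 2 * ((A.mulVec x - (fun i => |x i|) - b) ⬝ᵥ h) + A.mulVec h ⬝ᵥ h
      - ∑ i, (|x i + h i| * (x i + h i) - |x i| * x i - 2 * (|x i| * h i)) := by
  have hs : A.mulVec h ⬝ᵥ x = A.mulVec x ⬝ᵥ h := by
    rw [dotProduct_comm, dotProduct_mulVec, ← mulVec_transpose, hA]
  have e : ∑ i, (|x i + h i| * (x i + h i) - |x i| * x i - 2 * (|x i| * h i))
      = (fun i => |(x + h) i|) ⬝ᵥ (x + h) - (fun i => |x i|) ⬝ᵥ x
        - 2 * ((fun i => |x i|) ⬝ᵥ h) := by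
    simp only [dotProduct, Finset.sum_sub_distrib, Finset.mul_sum, Pi.add_apply]
  rw [e]
  simp only [mulVec_add, add_dotProduct, dotProduct_add, sub_dotProduct, hs]
  ring

lemma aux_lin (F C : ℝ) (h : ∀ t : ℝ, 0 ≤ 2 * (F * t) + C * (t * t)) : F = 0 := by
  have h1 := h (-F / (|C| + 1))
  have hD : 0 < |C| + 1 := by positivity
  have hC := le_abs_self C
  have h2 : 0 ≤ (2 * (F * (-F / (|C| + 1))) + C * ((-F / (|C| + 1)) * (-F / (|C| + 1)))) * (|C| + 1) ^ 2 := by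
    positivity
  have h3 : (2 * (F * (-F / (|C| + 1))) + C * ((-F / (|C| + 1)) * (-F / (|C| + 1)))) * (|C| + 1) ^ 2
    = F ^ 2 * (C - 2 * (|C| + 1)) := by
    field_simp
    ring
  rw [h3] at h2
  have : F ^ 2 = 0 := by
    have := abs_nonneg C
    nlinarith [sq_nonneg F]
  simpa using this

/-- Cyclic exact block coordinate descent for `f(x) = ⟨Ax, x⟩ - ⟨|x|, x⟩ - 2⟨b, x⟩` with
`A - I` symmetric positive definite: any iterate sequence that, cyclically over the blocks of a
partition of the coordinates, exactly minimizes `f` over the current block (keeping all other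
coordinates fixed) has a limit point solving the AVE `Ax - |x| = b`. -/
theorem stmt_17 (n N : ℕ) (hN : 0 < N)
    (A : Matrix (Fin n) (Fin n) ℝ) (hA : (A - 1).PosDef) (b : Fin n → ℝ)
    (B : Fin N → Set (Fin n))
    (hBne : ∀ s : Fin N, (B s).Nonempty)
    (hBdisj : ∀ s t : Fin N, s ≠ t → Disjoint (B s) (B t))
    (hBcover : (⋃ s : Fin N, B s) = Set.univ)
    (x : ℕ → Fin n → ℝ) :
    let f : (Fin n → ℝ) → ℝ := fun z =>
      A.mulVec z ⬝ᵥ z - (fun i => |z i|) ⬝ᵥ z - 2 * (b ⬝ᵥ z)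
    (∀ k : ℕ,
      (∀ i : Fin n, i ∉ B ⟨k % N, Nat.mod_lt k hN⟩ → x (k + 1) i = x k i) ∧
      (∀ y : Fin n → ℝ, (∀ i : Fin n, i ∉ B ⟨k % N, Nat.mod_lt k hN⟩ → y i = x k i) →
        f (x (k + 1)) ≤ f y)) →
    ∃ xstar : Fin n → ℝ, MapClusterPt xstar Filter.atTop x ∧
      A.mulVec xstar - (fun i => |xstar i|) = b := by
  intro f hx
  have hsymm : Aᵀ = A := by
    have h1 := hA.isHermitian
    have h2 : (A - 1)ᵀ = A - 1 := by simpa [Matrix.IsHermitian] using h1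
    simpa using h2
  obtain ⟨c, hc, hq⟩ := aux_quad _ hA
  set F : (Fin n → ℝ) → (Fin n → ℝ) := fun z => A.mulVec z - (fun i => |z i|) - b with hF
  have hFc : Continuous F := by
    have : Continuous (fun z : Fin n → ℝ => (fun i => |z i|)) := by fun_prop
    simp only [hF]
    fun_prop
  have hlow : ∀ z h, f z + 2 * (F z ⬝ᵥ h) + c * ‖h‖ ^ 2 ≤ f (z + h) := by
    intro z h
    have e := aux_expand A hsymm b z h
    have h1 : ∑ i, (|z i + h i| * (z i + h i) - |z i| * z i - 2 * (|z i| * h i)) ≤ h ⬝ᵥ h :=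
      Finset.sum_le_sum fun i _ => (abs_le.1 (aux_scalar (z i) (h i))).2
    have h2 := hq h
    rw [sub_mulVec, one_mulVec, sub_dotProduct] at h2
    simp only [f, hF]
    rw [e]
    linarith
  have hup : ∀ z h, f (z + h) ≤ f z + 2 * (F z ⬝ᵥ h) + (A.mulVec h ⬝ᵥ h + h ⬝ᵥ h) := by
    intro z h
    have e := aux_expand A hsymm b z h
    have h1 : ∑ i, -(h i * h i) ≤
        ∑ i, (|z i + h i| * (z i + h i) - |z i| * z i - 2 * (|z i| * h i)) :=
      Finset.sum_le_sum fun i _ => (abs_le.1 (aux_scalar (z i) (h i))).1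
    rw [Finset.sum_neg_distrib] at h1
    change -(h ⬝ᵥ h) ≤ _ at h1
    simp only [f, hF]
    rw [e]
    linarith
  have hopt : ∀ k i, i ∈ B ⟨k % N, Nat.mod_lt k hN⟩ → F (x (k + 1)) i = 0 := by
    intro k i hi
    apply aux_lin _ (A i i + 1)
    intro t
    have h1 := (hx k).2 (x (k + 1) + Pi.single i t) (by
      intro j hj
      have hji : j ≠ i := by
        rintro rfl
        exact hj hi
      simp [hji, (hx k).1 j hj])
    have h2 := hup (x (k + 1)) (Pi.single i t)
    simp only [dotProduct_single, mulVec_single, Pi.single_eq_same] at h2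
    simp at h2
    linarith
  have hdec : ∀ k, c * ‖x k - x (k + 1)‖ ^ 2 ≤ f (x k) - f (x (k + 1)) := by
    intro k
    have h1 := hlow (x (k + 1)) (x k - x (k + 1))
    have h2 : F (x (k + 1)) ⬝ᵥ (x k - x (k + 1)) = 0 := by
      apply Finset.sum_eq_zero
      intro i _
      by_cases hi : i ∈ B ⟨k % N, Nat.mod_lt k hN⟩
      · rw [hopt k i hi, zero_mul]
      · simp [(hx k).1 i hi]
    rw [h2, add_sub_cancel] at h1
    linarith
  have hanti : Antitone (fun k => f (x k)) := antitone_nat_of_succ_le fun k => by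
    have := hdec k
    have : 0 ≤ c * ‖x k - x (k + 1)‖ ^ 2 := by positivity
    linarith
  set β : ℝ := ∑ i, |b i| with hβ
  have hβ0 : 0 ≤ β := Finset.sum_nonneg fun i _ => abs_nonneg _
  have hcoer : ∀ z, c * ‖z‖ ^ 2 - 2 * (β * ‖z‖) ≤ f z := by
    intro z
    have h1 := hlow 0 z
    have h2 : f 0 = 0 := by simp [f]
    have h3 : F 0 = -b := by
      ext i
      simp [hF]
    have h4 : b ⬝ᵥ z ≤ β * ‖z‖ := by
      rw [hβ, Finset.sum_mul]
      refine Finset.sum_le_sum fun i _ => ?_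
      calc b i * z i ≤ |b i * z i| := le_abs_self _
        _ = |b i| * |z i| := abs_mul _ _
        _ ≤ _ := by
          gcongr
          exact norm_le_pi_norm z i
    rw [h2, h3, zero_add, zero_add, neg_dotProduct] at h1
    linarith
  have hbdd : BddBelow (Set.range fun k => f (x k)) := by
    refine ⟨-(β ^ 2 / c), ?_⟩
    rintro _ ⟨k, rfl⟩
    refine le_trans ?_ (hcoer (x k))
    have : c * ‖x k‖ ^ 2 - 2 * (β * ‖x k‖) + β ^ 2 / c = (c * ‖x k‖ - β) ^ 2 / c := by
      field_simp
      ring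
    have : 0 ≤ (c * ‖x k‖ - β) ^ 2 / c := by positivity
    linarith
  have hlim := tendsto_atTop_ciInf hanti hbdd
  have hdiff : Filter.Tendsto (fun k => f (x k) - f (x (k + 1))) Filter.atTop (nhds 0) := by
    have := hlim.sub (hlim.comp (Filter.tendsto_add_atTop_nat 1))
    simpa using this
  have hstep : Filter.Tendsto (fun k => x (k + 1) - x k) Filter.atTop (nhds 0) := by
    rw [tendsto_zero_iff_norm_tendsto_zero]
    have h1 : Filter.Tendsto (fun k => ‖x (k + 1) - x k‖ ^ 2) Filter.atTop (nhds 0) := by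
      have h2 := hdiff.div_const c
      rw [zero_div] at h2
      refine squeeze_zero (fun k => by positivity) (fun k => ?_) h2
      rw [le_div_iff₀ hc, norm_sub_rev]
      linarith [hdec k]
    have h3 := h1.sqrt
    simpa using h3
  -- boundedness
  obtain ⟨R, hR⟩ : ∃ R : ℝ, ∀ k, ‖x k‖ ≤ R := by
    refine ⟨(2 * β + |f (x 0)|) / c + 1, fun k => ?_⟩
    have h1 := (hcoer (x k)).trans (hanti (Nat.zero_le k))
    simp only at h1
    by_contra hcon
    push Not at hcon
    have h4 : 0 ≤ (2 * β + |f (x 0)|) / c := by positivity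
    have h2 : (2 * β + |f (x 0)|) < c * ‖x k‖ := by
      have : (2 * β + |f (x 0)|) / c < ‖x k‖ := by linarith
      rw [div_lt_iff₀ hc] at this
      linarith
    have h3 : 1 < ‖x k‖ := by linarith
    have h5 := le_abs_self (f (x 0))
    have h6 := abs_nonneg (f (x 0))
    nlinarith
  obtain ⟨xs, -, φ, hφ, hxs⟩ := (isCompact_closedBall (0 : Fin n → ℝ) R).tendsto_subseq
    (x := x) (fun k => by simpa using hR k)
  refine ⟨xs, hxs.mapClusterPt.of_comp hφ.tendsto_atTop, ?_⟩
  have hshift : ∀ m : ℕ, Filter.Tendsto (fun j => x (φ j + m)) Filter.atTop (nhds xs) := by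
    intro m
    induction m with
    | zero => exact hxs
    | succ m ih =>
      have h1 := hstep.comp ((Filter.tendsto_add_atTop_nat m).comp hφ.tendsto_atTop)
      have h2 := ih.add h1
      simp only [add_zero] at h2
      refine h2.congr fun j => ?_
      exact add_sub_cancel (x (φ j + m)) (x (φ j + m + 1))
  have hzero : ∀ i, F xs i = 0 := by
    intro i
    have h1 : Filter.Tendsto (fun j => ∏ m ∈ Finset.range (N + 1), F (x (φ j + m)) i)
        Filter.atTop (nhds (∏ m ∈ Finset.range (N + 1), F xs i)) := by
      refine tendsto_finsetProd _ fun m _ => ?_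
      exact (((continuous_apply i).comp hFc).tendsto xs).comp (hshift m)
    have h2 : ∀ j, ∏ m ∈ Finset.range (N + 1), F (x (φ j + m)) i = 0 := by
      intro j
      obtain ⟨s, hs⟩ : ∃ s, i ∈ B s := by
        have : i ∈ ⋃ s : Fin N, B s := by rw [hBcover]; trivial
        simpa using this
      obtain ⟨m, hm, hms⟩ : ∃ m < N, (φ j + m) % N = s := by
        refine ⟨(s + (N - φ j % N)) % N, Nat.mod_lt _ hN, ?_⟩
        have h5 := Nat.mod_lt (φ j) hN
        rw [Nat.add_mod, Nat.mod_mod, ← Nat.add_mod, ← Nat.mod_add_mod,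
          show φ j % N + (s + (N - φ j % N)) = s + N by omega, Nat.add_mod_right,
          Nat.mod_eq_of_lt s.2]
      apply Finset.prod_eq_zero (i := m + 1) (by simpa using hm)
      rw [← add_assoc]
      apply hopt
      have : (⟨(φ j + m) % N, Nat.mod_lt _ hN⟩ : Fin N) = s := Fin.ext hms
      rw [this]
      exact hs
    have h3 := tendsto_nhds_unique h1 (by simp only [h2]; exact tendsto_const_nhds)
    simpa using h3
  ext i
  have := hzero i
  simp only [hF, Pi.sub_apply] at this ⊢
  linarith
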